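/- Let X and Y be Banach spaces, μ0 a Borel probability measure on X, and fix y ∈ Y. Let Φ : X × Y → ℝ and Φ_N : X × Y → ℝ (N ∈ ℕ) be such that Φ(·;y) and each Φ_N(·;y) are Borel measurable, and suppose both Φ and all Φ_N satisfy, uniformly in N: (i) there is a nondecreasing f1 : [0,∞) → [1,∞) such that for every r > 0 there is M(r) ∈ ℝ with Φ(u;y) ≥ M(r) − log f1(‖u‖_X) and Φ_N(u;y) ≥ M(r) − log f1(‖u‖_X) for all u ∈ X, y ∈ B_Y(r); and (ii) for every r > 0 there is K(r) > 0 bounding Φ(u;y) ≤ K(r) and Φ_N(u;y) ≤ K(r) on B_X(r) × B_Y(r). Suppose further that there is a nondecreasing function f3 : [0,∞) → [0,∞) and ρ : ℕ → [0,∞) with ρ(N) → 0 such that |Φ(u;y) − Φ_N(u;y)| ≤ f3(‖u‖_X) ρ(N) for all u ∈ X and N. Let μ^y and μ^y_N be the posteriors with potentials Φ(·;y) and Φ_N(·;y). Then: (a) if ∫ f3(‖u‖_X) f1(‖u‖_X) dμ0(u) < ∞ there is D > 0 independent of N with d_TV(μ^y, μ^y_N) ≤ D ρ(N); (b) if ∫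 f3(‖u‖_X)² f1(‖u‖_X) dμ0(u) < ∞ there is D' > 0 independent of N with d_H(μ^y, μ^y_N) ≤ D' ρ(N). -/

import Mathlib

open MeasureTheory Real Filter

/-- Lipschitz bound for `t ↦ exp (-t)` on a region where it is at most `F`. -/
lemma abs_exp_neg_sub_exp_neg_le {a b F : ℝ} (ha : exp (-a) ≤ F) (hb : exp (-b) ≤ F) :
    |exp (-a) - exp (-b)| ≤ F * |a - b| := by
  wlog hab : a ≤ b generalizing a b
  · rw [abs_sub_comm, abs_sub_comm a b]
    exact this hb ha (le_of_not_ge hab)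
  have hmono : exp (-b) ≤ exp (-a) := exp_le_exp.mpr (by linarith)
  have hsplit : exp (-b) = exp (-a) * exp (a - b) := by rw [← exp_add]; ring_nf
  have hlin := add_one_le_exp (a - b)
  rw [abs_of_nonneg (by linarith), abs_sub_comm a b, abs_of_nonneg (by linarith)]
  nlinarith [exp_pos (-a)]

lemma sq_sqrt_exp_neg_sub_le {a b F : ℝ} (ha : exp (-a) ≤ F) (hb : exp (-b) ≤ F) :
    (√(exp (-a)) - √(exp (-b))) ^ 2 ≤ F * (a - b) ^ 2 := by
  have hF : 0 ≤ F := (exp_pos _).le.trans ha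
  have key (c : ℝ) : √(exp (-c)) = exp (-(c / 2)) := by rw [← neg_div, exp_half]
  have hlip := abs_exp_neg_sub_exp_neg_le (F := √F)
    (by rw [← key]; exact sqrt_le_sqrt ha) (by rw [← key]; exact sqrt_le_sqrt hb)
  have hsq := pow_le_pow_left₀ (abs_nonneg _) hlip 2
  rw [sq_abs, mul_pow, sq_abs, sq_sqrt hF] at hsq
  rw [key, key]
  nlinarith [mul_nonneg hF (sq_nonneg (a - b))]

section Normalization

variable {X : Type*} [MeasurableSpace X] {μ : Measure X} {g h : X → ℝ}

lemma abs_integral_sub_integral_le (hg : Integrable g μ) (hh : Integrable h μ) :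
    |(∫ v, g v ∂μ) - ∫ v, h v ∂μ| ≤ ∫ u, |g u - h u| ∂μ := by
  rw [← integral_sub hg hh]
  exact abs_integral_le_integral_abs

/-- The `L¹` distance of normalized densities is controlled by that of the unnormalized ones. -/
lemma integral_abs_div_integral_sub_le (hg : Integrable g μ) (hh : Integrable h μ)
    (hh0 : ∀ u, 0 ≤ h u) (hZ : 0 < ∫ v, g v ∂μ) (hZ' : 0 < ∫ v, h v ∂μ) :
    ∫ u, |g u / (∫ v, g v ∂μ) - h u / (∫ v, h v ∂μ)| ∂μ
      ≤ 2 / (∫ v, g v ∂μ) * ∫ u, |g u - h u| ∂μ := by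
  have hdiff := abs_integral_sub_integral_le hg hh
  set Z := ∫ v, g v ∂μ
  set Z' := ∫ v, h v ∂μ with hZ'_def
  have hpt (u : X) : |g u / Z - h u / Z'| ≤ |g u - h u| / Z + h u * (|Z - Z'| / (Z * Z')) := by
    have hsplit : g u / Z - h u / Z' = (g u - h u) / Z + h u * (-(Z - Z') / (Z * Z')) := by
      field_simp
      ring
    rw [hsplit]
    refine (abs_add_le _ _).trans_eq ?_
    rw [abs_div, abs_mul, abs_div, abs_neg, abs_of_nonneg (hh0 u), abs_of_pos hZ,
      abs_of_pos (mul_pos hZ hZ')]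
  have hint₁ : Integrable (fun u => |g u - h u| / Z) μ := (hg.sub hh).abs.div_const Z
  have hint₂ := hh.mul_const (|Z - Z'| / (Z * Z'))
  calc ∫ u, |g u / Z - h u / Z'| ∂μ
      ≤ ∫ u, (|g u - h u| / Z + h u * (|Z - Z'| / (Z * Z'))) ∂μ :=
        integral_mono_of_nonneg (.of_forall fun _ => abs_nonneg _) (hint₁.add hint₂)
          (.of_forall hpt)
    _ = (∫ u, |g u - h u| ∂μ) / Z + |Z - Z'| / Z := by
        rw [integral_add hint₁ hint₂, integral_div, integral_mul_const, ← hZ'_def]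
        field_simp
    _ ≤ (∫ u, |g u - h u| ∂μ) / Z + (∫ u, |g u - h u| ∂μ) / Z := by gcongr
    _ = 2 / Z * ∫ u, |g u - h u| ∂μ := by ring

/-- The squared Hellinger distance of normalized densities is controlled by that of the
unnormalized ones and the difference of the normalizing constants. -/
lemma integral_sq_sqrt_div_integral_sub_le (hg : Integrable g μ) (hh : Integrable h μ)
    (hg0 : ∀ u, 0 ≤ g u) (hh0 : ∀ u, 0 ≤ h u)
    (hZ : 0 < ∫ v, g v ∂μ) (hZ' : 0 < ∫ v, h v ∂μ) :
    ∫ u, (√(g u / (∫ v, g v ∂μ)) - √(h u / (∫ v, h v ∂μ))) ^ 2 ∂μ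
      ≤ 2 / (∫ v, g v ∂μ) * ((∫ u, (√(g u) - √(h u)) ^ 2 ∂μ)
        + ((∫ v, g v ∂μ) - ∫ v, h v ∂μ) ^ 2 / ∫ v, g v ∂μ) := by
  set Z := ∫ v, g v ∂μ
  set Z' := ∫ v, h v ∂μ with hZ'_def
  have hs : 0 < √Z := sqrt_pos.mpr hZ
  have hs' : 0 < √Z' := sqrt_pos.mpr hZ'
  have hsZ : √Z ^ 2 = Z := sq_sqrt hZ.le
  have hsZ' : √Z' ^ 2 = Z' := sq_sqrt hZ'.le
  have hpt (u : X) : (√(g u / Z) - √(h u / Z')) ^ 2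
      ≤ 2 / Z * (√(g u) - √(h u)) ^ 2 + h u * (2 * (1 / √Z - 1 / √Z') ^ 2) := by
    have hfirst : 2 / Z * (√(g u) - √(h u)) ^ 2 = 2 * ((√(g u) - √(h u)) / √Z) ^ 2 := by
      rw [div_pow, hsZ]
      ring
    have hsecond : h u * (2 * (1 / √Z - 1 / √Z') ^ 2)
        = 2 * (√(h u) * (1 / √Z - 1 / √Z')) ^ 2 := by
      rw [mul_pow, sq_sqrt (hh0 u)]
      ring
    have hsplit : √(g u / Z) - √(h u / Z')
        = (√(g u) - √(h u)) / √Z + √(h u) * (1 / √Z - 1 / √Z') := by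
      rw [sqrt_div (hg0 u), sqrt_div (hh0 u)]
      ring
    rw [hfirst, hsecond, hsplit]
    linarith [add_sq_le (a := (√(g u) - √(h u)) / √Z) (b := √(h u) * (1 / √Z - 1 / √Z'))]
  have hint : Integrable (fun u => (√(g u) - √(h u)) ^ 2) μ := by
    refine Integrable.mono' (hg.add hh) ?_ (.of_forall fun u => ?_)
    · exact ((continuous_sqrt.comp_aestronglyMeasurable hg.1).sub
        (continuous_sqrt.comp_aestronglyMeasurable hh.1)).pow 2
    · rw [norm_of_nonneg (sq_nonneg _), Pi.add_apply]
      nlinarith [sq_sqrt (hg0 u), sq_sqrt (hh0 u), sqrt_nonneg (g u), sqrt_nonneg (h u),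
        mul_nonneg (sqrt_nonneg (g u)) (sqrt_nonneg (h u))]
  have hint₁ := hint.const_mul (2 / Z)
  have hint₂ := hh.mul_const (2 * (1 / √Z - 1 / √Z') ^ 2)
  have hconst : Z' * (1 / √Z - 1 / √Z') ^ 2 = (√Z - √Z') ^ 2 / Z := by
    rw [← hsZ, ← hsZ', sqrt_sq hs.le, sqrt_sq hs'.le]
    field_simp
    ring
  have hsqrt : (√Z - √Z') ^ 2 ≤ (Z - Z') ^ 2 / Z := by
    rw [le_div_iff₀ hZ]
    have hfactor : (Z - Z') ^ 2 = (√Z - √Z') ^ 2 * (√Z + √Z') ^ 2 := by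
      nth_rewrite 1 [← hsZ, ← hsZ']
      ring
    rw [hfactor]
    refine mul_le_mul_of_nonneg_left ?_ (sq_nonneg _)
    nlinarith
  calc ∫ u, (√(g u / Z) - √(h u / Z')) ^ 2 ∂μ
      ≤ ∫ u, (2 / Z * (√(g u) - √(h u)) ^ 2 + h u * (2 * (1 / √Z - 1 / √Z') ^ 2)) ∂μ :=
        integral_mono_of_nonneg (.of_forall fun _ => sq_nonneg _) (hint₁.add hint₂)
          (.of_forall hpt)
    _ = 2 / Z * (∫ u, (√(g u) - √(h u)) ^ 2 ∂μ) + 2 * (Z' * (1 / √Z - 1 / √Z') ^ 2) := by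
        rw [integral_add hint₁ hint₂, integral_const_mul, integral_mul_const, ← hZ'_def]
        ring
    _ = 2 / Z * ((∫ u, (√(g u) - √(h u)) ^ 2 ∂μ) + (√Z - √Z') ^ 2) := by
        rw [hconst]
        ring
    _ ≤ _ := by gcongr

end Normalization

lemma measurable_comp_norm_of_monotoneOn {X : Type*} [NormedAddCommGroup X] [MeasurableSpace X]
    [BorelSpace X] {f : ℝ → ℝ} (hf : MonotoneOn f (Set.Ici 0)) :
    Measurable fun u : X => f ‖u‖ := by
  have hmono : Monotone fun t : ℝ => f (max t 0) := fun s t hst =>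
    hf (Set.mem_Ici.mpr (le_max_right _ _)) (Set.mem_Ici.mpr (le_max_right _ _))
      (max_le_max_right 0 hst)
  simpa [Function.comp_def] using hmono.measurable.comp (measurable_norm (α := X))

/-- If a product `k(‖u‖) f(‖u‖)` with nondecreasing nonnegative factors is integrable and `k` is
positive somewhere, then `f(‖u‖)` is integrable. -/
lemma integrable_comp_norm_of_mul {X : Type*} [NormedAddCommGroup X] [MeasurableSpace X]
    [BorelSpace X] {μ : Measure X} [IsFiniteMeasure μ] {k f : ℝ → ℝ}
    (hk : MonotoneOn k (Set.Ici 0)) (hk0 : ∀ t, 0 ≤ t → 0 ≤ k t)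
    (hf : MonotoneOn f (Set.Ici 0)) (hf0 : ∀ t, 0 ≤ t → 0 ≤ f t)
    {u₀ : X} (hu₀ : 0 < k ‖u₀‖) (hint : Integrable (fun u => k ‖u‖ * f ‖u‖) μ) :
    Integrable (fun u => f ‖u‖) μ := by
  refine Integrable.mono' ((integrable_const (f ‖u₀‖)).add (hint.div_const (k ‖u₀‖)))
    (measurable_comp_norm_of_monotoneOn hf).aestronglyMeasurable (.of_forall fun u => ?_)
  have hfu := hf0 _ (norm_nonneg u)
  rw [norm_of_nonneg hfu, Pi.add_apply]
  rcases le_total ‖u‖ ‖u₀‖ with hle | hle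
  · have hmono := hf (norm_nonneg u) (norm_nonneg u₀) hle
    have hquot := div_nonneg (mul_nonneg (hk0 _ (norm_nonneg u)) hfu) hu₀.le
    linarith
  · have hmono := hk (norm_nonneg u₀) (norm_nonneg u) hle
    have hquot : f ‖u‖ ≤ k ‖u‖ * f ‖u‖ / k ‖u₀‖ := by
      rw [le_div_iff₀ hu₀, mul_comm]
      exact mul_le_mul_of_nonneg_right hmono hfu
    linarith [hf0 _ (norm_nonneg u₀)]

/-- Consistent approximation of the posterior: if `Φ` and the
approximations `Φ_N` satisfy Assumptions (i), (ii) uniformly in `N` and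
`|Φ(u;y) − Φ_N(u;y)| ≤ f3(‖u‖) ρ(N)` with `ρ(N) → 0`, then the approximate
posteriors converge to the posterior at rate `ρ(N)` in total variation
(if `f3·f1` is integrable) and in Hellinger distance (if `f3²·f1` is
integrable), with the distances computed with `ν = μ0`. -/
theorem consistent_approximation
    {X Y : Type*} [NormedAddCommGroup X] [NormedSpace ℝ X] [CompleteSpace X]
    [MeasurableSpace X] [BorelSpace X]
    [NormedAddCommGroup Y] [NormedSpace ℝ Y] [CompleteSpace Y]
    (μ0 : Measure X) [IsProbabilityMeasure μ0]
    (y : Y)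
    (Φ : X → Y → ℝ) (ΦN : ℕ → X → Y → ℝ)
    (hmeas : Measurable (fun u => Φ u y))
    (hmeasN : ∀ N, Measurable (fun u => ΦN N u y))
    (f1 : ℝ → ℝ)
    (hf1_mono : MonotoneOn f1 (Set.Ici 0))
    (hf1_ge : ∀ t : ℝ, 0 ≤ t → 1 ≤ f1 t)
    (hi : ∀ r > 0, ∃ M : ℝ, ∀ u : X, ∀ y' : Y, ‖y'‖ < r →
      M - Real.log (f1 ‖u‖) ≤ Φ u y' ∧ ∀ N, M - Real.log (f1 ‖u‖) ≤ ΦN N u y')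
    (hii : ∀ r > 0, ∃ K > 0, ∀ u : X, ∀ y' : Y, ‖u‖ < r → ‖y'‖ < r →
      Φ u y' ≤ K ∧ ∀ N, ΦN N u y' ≤ K)
    (f3 : ℝ → ℝ)
    (hf3_mono : MonotoneOn f3 (Set.Ici 0))
    (hf3_nonneg : ∀ t : ℝ, 0 ≤ t → 0 ≤ f3 t)
    (ρ : ℕ → ℝ) (hρ_nonneg : ∀ N, 0 ≤ ρ N)
    (hρ : Tendsto ρ atTop (nhds 0))
    (happrox : ∀ (u : X) (N : ℕ), |Φ u y - ΦN N u y| ≤ f3 ‖u‖ * ρ N) :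
    (Integrable (fun u => f3 ‖u‖ * f1 ‖u‖) μ0 →
      ∃ D > 0, ∀ N : ℕ,
        (1 / 2) * ∫ u,
            |Real.exp (-(Φ u y)) / (∫ v, Real.exp (-(Φ v y)) ∂μ0) -
              Real.exp (-(ΦN N u y)) / (∫ v, Real.exp (-(ΦN N v y)) ∂μ0)| ∂μ0
          ≤ D * ρ N) ∧
    (Integrable (fun u => (f3 ‖u‖) ^ 2 * f1 ‖u‖) μ0 →
      ∃ D' > 0, ∀ N : ℕ,
        Real.sqrt ((1 / 2) * ∫ u,
            (Real.sqrt (Real.exp (-(Φ u y)) / (∫ v, Real.exp (-(Φ v y)) ∂μ0)) -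
              Real.sqrt (Real.exp (-(ΦN N u y)) / (∫ v, Real.exp (-(ΦN N v y)) ∂μ0))) ^ 2 ∂μ0)
          ≤ D' * ρ N) := by
  obtain ⟨M, hM⟩ := hi (‖y‖ + 1) (by positivity)
  have hF (u : X) (t : ℝ) (ht : M - log (f1 ‖u‖) ≤ t) : exp (-t) ≤ exp (-M) * f1 ‖u‖ := by
    rw [← exp_log (zero_lt_one.trans_le (hf1_ge _ (norm_nonneg u))), ← exp_add]
    exact exp_le_exp.mpr (by linarith)
  have hΦ (u : X) := hF u _ (hM u y (by linarith)).1
  have hΦN (N : ℕ) (u : X) := hF u _ ((hM u y (by linarith)).2 N)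
  have hf1_nonneg (t : ℝ) (ht : 0 ≤ t) : 0 ≤ f1 t := zero_le_one.trans (hf1_ge t ht)
  by_cases hzero : ∀ u : X, f3 ‖u‖ = 0
  · have heq (N : ℕ) (u : X) : ΦN N u y = Φ u y := by
      have hle := happrox u N
      rw [hzero u, zero_mul] at hle
      exact (sub_eq_zero.mp (abs_nonpos_iff.mp hle)).symm
    exact ⟨fun _ => ⟨1, one_pos, fun N => by simpa [heq] using hρ_nonneg N⟩,
      fun _ => ⟨1, one_pos, fun N => by simpa [heq] using hρ_nonneg N⟩⟩
  push Not at hzero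
  obtain ⟨u₀, hu₀⟩ := hzero
  replace hu₀ : 0 < f3 ‖u₀‖ := lt_of_le_of_ne (hf3_nonneg _ (norm_nonneg _)) hu₀.symm
  have hexp (hf1 : Integrable (fun u : X => f1 ‖u‖) μ0) (Ψ : X → ℝ) (hΨ : Measurable Ψ)
      (hle : ∀ u, exp (-(Ψ u)) ≤ exp (-M) * f1 ‖u‖) :
      Integrable (fun u => exp (-(Ψ u))) μ0 :=
    (hf1.const_mul (exp (-M))).mono' hΨ.neg.exp.aestronglyMeasurable
      (.of_forall fun u => by simpa using hle u)
  have hL1 (hf31 : Integrable (fun u => f3 ‖u‖ * f1 ‖u‖) μ0) (N : ℕ) :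
      ∫ u, |exp (-(Φ u y)) - exp (-(ΦN N u y))| ∂μ0
        ≤ exp (-M) * (∫ u, f3 ‖u‖ * f1 ‖u‖ ∂μ0) * ρ N := by
    rw [← integral_const_mul, ← integral_mul_const]
    refine integral_mono_of_nonneg (.of_forall fun _ => abs_nonneg _)
      ((hf31.const_mul _).mul_const _) (.of_forall fun u => ?_)
    refine (abs_exp_neg_sub_exp_neg_le (hΦ u) (hΦN N u)).trans ?_
    have hF0 := (exp_pos _).le.trans (hΦ u)
    refine (mul_le_mul_of_nonneg_left (happrox u N) hF0).trans_eq ?_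
    ring
  have hI1 : 0 ≤ ∫ u, f3 ‖u‖ * f1 ‖u‖ ∂μ0 := integral_nonneg fun u =>
    mul_nonneg (hf3_nonneg _ (norm_nonneg u)) (hf1_nonneg _ (norm_nonneg u))
  refine ⟨fun hf31 => ?_, fun hf331 => ?_⟩
  · have hf1 := integrable_comp_norm_of_mul hf3_mono hf3_nonneg hf1_mono hf1_nonneg hu₀ hf31
    have hg := hexp hf1 _ hmeas hΦ
    have hh (N : ℕ) := hexp hf1 _ (hmeasN N) (hΦN N)
    have hZ := integral_exp_pos hg
    refine ⟨exp (-M) * (∫ u, f3 ‖u‖ * f1 ‖u‖ ∂μ0) / (∫ v, exp (-(Φ v y)) ∂μ0) + 1,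
      by positivity, fun N => ?_⟩
    have hTV := integral_abs_div_integral_sub_le hg (hh N) (fun _ => (exp_pos _).le) hZ
      (integral_exp_pos (hh N))
    have hbound := hTV.trans (mul_le_mul_of_nonneg_left (hL1 hf31 N) (by positivity))
    refine (mul_le_mul_of_nonneg_left hbound (by norm_num)).trans ?_
    rw [add_mul, one_mul]
    refine le_trans (le_of_eq ?_) (le_add_of_nonneg_right (hρ_nonneg N))
    ring
  · have hf1 := integrable_comp_norm_of_mul (k := fun t => f3 t ^ 2)
      (fun s hs t ht hst => pow_le_pow_left₀ (hf3_nonneg s hs) (hf3_mono hs ht hst) 2)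
      (fun _ _ => sq_nonneg _) hf1_mono hf1_nonneg (pow_pos hu₀ 2) hf331
    have hf31 : Integrable (fun u => f3 ‖u‖ * f1 ‖u‖) μ0 := by
      refine (hf1.add hf331).mono' ((measurable_comp_norm_of_monotoneOn hf3_mono).mul
        (measurable_comp_norm_of_monotoneOn hf1_mono)).aestronglyMeasurable
        (.of_forall fun u => ?_)
      have hf1u := hf1_nonneg _ (norm_nonneg u)
      rw [norm_of_nonneg (mul_nonneg (hf3_nonneg _ (norm_nonneg u)) hf1u), Pi.add_apply]
      nlinarith [mul_nonneg hf1u (sq_nonneg (f3 ‖u‖ - 1)), mul_nonneg hf1u (sq_nonneg (f3 ‖u‖))]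
    have hg := hexp hf1 _ hmeas hΦ
    have hh (N : ℕ) := hexp hf1 _ (hmeasN N) (hΦN N)
    have hZ := integral_exp_pos hg
    have hI2 : 0 ≤ ∫ u, f3 ‖u‖ ^ 2 * f1 ‖u‖ ∂μ0 := integral_nonneg fun u =>
      mul_nonneg (sq_nonneg _) (hf1_nonneg _ (norm_nonneg u))
    have hL2 (N : ℕ) : ∫ u, (√(exp (-(Φ u y))) - √(exp (-(ΦN N u y)))) ^ 2 ∂μ0
        ≤ exp (-M) * (∫ u, f3 ‖u‖ ^ 2 * f1 ‖u‖ ∂μ0) * ρ N ^ 2 := by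
      rw [← integral_const_mul, ← integral_mul_const]
      refine integral_mono_of_nonneg (.of_forall fun _ => sq_nonneg _)
        ((hf331.const_mul _).mul_const _) (.of_forall fun u => ?_)
      refine (sq_sqrt_exp_neg_sub_le (hΦ u) (hΦN N u)).trans ?_
      have hF0 := (exp_pos _).le.trans (hΦ u)
      have hsq := pow_le_pow_left₀ (abs_nonneg _) (happrox u N) 2
      rw [sq_abs] at hsq
      refine (mul_le_mul_of_nonneg_left hsq hF0).trans_eq ?_
      ring
    have hdiff (N : ℕ) : ((∫ v, exp (-(Φ v y)) ∂μ0) - ∫ v, exp (-(ΦN N v y)) ∂μ0) ^ 2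
        ≤ (exp (-M) * (∫ u, f3 ‖u‖ * f1 ‖u‖ ∂μ0)) ^ 2 * ρ N ^ 2 := by
      rw [← sq_abs, ← mul_pow]
      exact pow_le_pow_left₀ (abs_nonneg _)
        ((abs_integral_sub_integral_le hg (hh N)).trans (hL1 hf31 N)) 2
    have hHell (N : ℕ) := integral_sq_sqrt_div_integral_sub_le hg (hh N)
      (fun _ => (exp_pos _).le) (fun _ => (exp_pos _).le) hZ (integral_exp_pos (hh N))
    set Z := ∫ v, exp (-(Φ v y)) ∂μ0
    set I1 := ∫ u, f3 ‖u‖ * f1 ‖u‖ ∂μ0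
    set I2 := ∫ u, f3 ‖u‖ ^ 2 * f1 ‖u‖ ∂μ0
    set C := 1 / Z * (exp (-M) * I2 + (exp (-M) * I1) ^ 2 / Z) with hC_def
    have hC : 0 ≤ C := by positivity
    refine ⟨√C + 1, by positivity, fun N => ?_⟩
    have hbound := (hHell N).trans (mul_le_mul_of_nonneg_left
      (add_le_add (hL2 N) (div_le_div_of_nonneg_right (hdiff N) hZ.le)) (by positivity))
    calc _ ≤ √(C * ρ N ^ 2) := by
            refine sqrt_le_sqrt ((mul_le_mul_of_nonneg_left hbound (by norm_num)).trans_eq ?_)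
            rw [hC_def]
            ring
      _ = √C * ρ N := by rw [sqrt_mul hC, sqrt_sq (hρ_nonneg N)]
      _ ≤ (√C + 1) * ρ N := by nlinarith [hρ_nonneg N]
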